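/- arXiv:1804.00690 — 6 statements merged into one kernel-verified Lean document; each statement's English description precedes it below -/
import Mathlib

section
/- For every odd prime p and every complex number z with |z| ≤ p^{−1/2}, one has |f_odd(z; p)| ≤ 107·|z|, with strict inequality when z ≠ 0, where f_odd(z; p) = z(1 + 7z² + 7z⁴ + z⁶) / ((1 − z²)⁷ (1 − p z⁴)). -/
open Complex

/-- The generating function `f_odd(z; p)`. -/
noncomputable def fOdd (p : ℕ) (z : ℂ) : ℂ :=
  z * (1 + 7 * z ^ 2 + 7 * z ^ 4 + z ^ 6) / ((1 - z ^ 2) ^ 7 * (1 - (p : ℂ) * z ^ 4))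

/-- If `‖z‖ ^ 2 ≤ 1 / p` and `3 ≤ p`, the cofactor of `z` in `fOdd p z` has norm below `107`. -/
theorem norm_fOdd_cofactor_lt {p : ℕ} (hp : 3 ≤ p) {z : ℂ} (hz : p * ‖z‖ ^ 2 ≤ 1) :
    ‖(1 + 7 * z ^ 2 + 7 * z ^ 4 + z ^ 6) / ((1 - z ^ 2) ^ 7 * (1 - (p : ℂ) * z ^ 4))‖ < 107 := by
  have hp' : (3 : ℝ) ≤ p := by exact_mod_cast hp
  have h2 : ‖z‖ ^ 2 ≤ 1 / 3 := by nlinarith [sq_nonneg ‖z‖]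
  have h4 : ‖z‖ ^ 4 ≤ 1 / 9 := by nlinarith [sq_nonneg ‖z‖]
  have h6 : ‖z‖ ^ 6 ≤ 1 / 27 := by
    calc ‖z‖ ^ 6 = (‖z‖ ^ 2) ^ 3 := by ring
      _ ≤ (1 / 3) ^ 3 := by gcongr
      _ = 1 / 27 := by norm_num
  have hp4 : p * ‖z‖ ^ 4 ≤ 1 / 3 := by nlinarith [sq_nonneg ‖z‖]
  have hnum : ‖1 + 7 * z ^ 2 + 7 * z ^ 4 + z ^ 6‖ ≤ 112 / 27 := by
    calc ‖1 + 7 * z ^ 2 + 7 * z ^ 4 + z ^ 6‖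
        ≤ ‖(1 : ℂ)‖ + ‖7 * z ^ 2‖ + ‖7 * z ^ 4‖ + ‖z ^ 6‖ := norm_add₄_le
      _ = 1 + 7 * ‖z‖ ^ 2 + 7 * ‖z‖ ^ 4 + ‖z‖ ^ 6 := by simp
      _ ≤ 112 / 27 := by linarith
  have hleft : 2 / 3 ≤ ‖1 - z ^ 2‖ := by
    have h := norm_sub_norm_le (1 : ℂ) (z ^ 2)
    rw [norm_one, norm_pow] at h
    linarith
  have hright : 2 / 3 ≤ ‖1 - (p : ℂ) * z ^ 4‖ := by
    have h := norm_sub_norm_le (1 : ℂ) (p * z ^ 4)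
    rw [norm_one, norm_mul, norm_pow, norm_natCast] at h
    linarith
  have hden : (2 / 3 : ℝ) ^ 7 * (2 / 3) ≤ ‖(1 - z ^ 2) ^ 7 * (1 - (p : ℂ) * z ^ 4)‖ := by
    rw [norm_mul, norm_pow]
    gcongr
  rw [norm_div, div_lt_iff₀ (lt_of_lt_of_le (by norm_num) hden)]
  linarith

theorem stmt3 (p : ℕ) (hp : p.Prime) (hodd : Odd p) (z : ℂ)
    (hz : ‖z‖ ≤ (p : ℝ) ^ (-(1 / 2) : ℝ)) :
    ‖fOdd p z‖ ≤ 107 * ‖z‖ ∧ (z ≠ 0 → ‖fOdd p z‖ < 107 * ‖z‖) := by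
  have hp3 : 3 ≤ p := by
    have := hp.two_le
    obtain ⟨k, rfl⟩ := hodd
    omega
  have hp0 : (0 : ℝ) < p := by exact_mod_cast hp.pos
  have hz2 : p * ‖z‖ ^ 2 ≤ 1 := by
    calc p * ‖z‖ ^ 2 ≤ p * ((p : ℝ) ^ (-(1 / 2) : ℝ)) ^ 2 := by gcongr
      _ = 1 := by
        rw [← Real.rpow_mul_natCast hp0.le]
        norm_num [Real.rpow_neg_one, hp0.ne']
  have hlt := norm_fOdd_cofactor_lt hp3 hz2
  rw [fOdd, mul_div_assoc, norm_mul, mul_comm ‖z‖]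
  exact ⟨by gcongr, fun hne => mul_lt_mul_of_pos_right hlt (norm_pos_iff.mpr hne)⟩
end

section
/- For every odd prime p and every complex number z with |z| ≤ p^{−1/2}, the denominator polynomial D_p(z) is nonzero and |(1 − p^{−1})³ (1 − z²)⁷ (1 − p z⁴) / D_p(z)| < 25, where D_p(z) = 1 + 3p^{−1} + (7 − 15p^{−1} + p^{−2} − p^{−3})z² + (7 − 35p^{−1} + 35p^{−2} − 7p^{−3})z⁴ + (1 − p^{−1} + 15p^{−2} − 7p^{−3})z⁶ − (3p^{−2} + p^{−3})z⁸. -/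
open Complex

/-- The denominator polynomial `D_p(z)`. -/
noncomputable def Dpoly (p : ℕ) (z : ℂ) : ℂ :=
  1 + 3 * (p : ℂ)⁻¹
    + (7 - 15 * (p : ℂ)⁻¹ + (p : ℂ)⁻¹ ^ 2 - (p : ℂ)⁻¹ ^ 3) * z ^ 2
    + (7 - 35 * (p : ℂ)⁻¹ + 35 * (p : ℂ)⁻¹ ^ 2 - 7 * (p : ℂ)⁻¹ ^ 3) * z ^ 4
    + (1 - (p : ℂ)⁻¹ + 15 * (p : ℂ)⁻¹ ^ 2 - 7 * (p : ℂ)⁻¹ ^ 3) * z ^ 6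
    - (3 * (p : ℂ)⁻¹ ^ 2 + (p : ℂ)⁻¹ ^ 3) * z ^ 8

theorem norm_quartic_ge (a b c d e : ℝ) (w : ℂ) :
    a - |b| * ‖w‖ - |c| * ‖w‖ ^ 2 - |d| * ‖w‖ ^ 3 - |e| * ‖w‖ ^ 4 ≤
      ‖(a : ℂ) + b * w + c * w ^ 2 + d * w ^ 3 - e * w ^ 4‖ := by
  set s : ℂ := (a : ℂ) + b * w + c * w ^ 2 + d * w ^ 3 - e * w ^ 4 with hs
  have ha : (a : ℂ) = s - b * w - c * w ^ 2 - d * w ^ 3 + e * w ^ 4 := by rw [hs]; ring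
  have h : ‖(a : ℂ)‖ ≤ ‖s‖ + ‖(b : ℂ) * w‖ + ‖(c : ℂ) * w ^ 2‖ + ‖(d : ℂ) * w ^ 3‖
      + ‖(e : ℂ) * w ^ 4‖ := by
    rw [ha]
    refine (norm_add_le _ _).trans (add_le_add_left ?_ _)
    refine (norm_sub_le _ _).trans (add_le_add_left ?_ _)
    refine (norm_sub_le _ _).trans (add_le_add_left ?_ _)
    exact norm_sub_le _ _
  simp only [norm_mul, norm_pow, Complex.norm_real, Real.norm_eq_abs] at h
  linarith [le_abs_self a]

theorem norm_denominator_gt {q : ℝ} (h0 : 0 ≤ q) (h1 : q ≤ 1 / 3) {w : ℂ} (hw : ‖w‖ ≤ q) :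
    1 / 4 < ‖((1 + 3 * q : ℝ) : ℂ) + ((7 - 15 * q + q ^ 2 - q ^ 3 : ℝ) : ℂ) * w
      + ((7 - 35 * q + 35 * q ^ 2 - 7 * q ^ 3 : ℝ) : ℂ) * w ^ 2
      + ((1 - q + 15 * q ^ 2 - 7 * q ^ 3 : ℝ) : ℂ) * w ^ 3
      - ((3 * q ^ 2 + q ^ 3 : ℝ) : ℂ) * w ^ 4‖ := by
  refine lt_of_lt_of_le ?_ (norm_quartic_ge _ _ _ _ _ w)
  have q2 : q ^ 2 ≤ q / 3 := by nlinarith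
  have q20 : 0 ≤ q ^ 2 := by positivity
  have q30 : 0 ≤ q ^ 3 := by positivity
  have q3 : q ^ 3 ≤ q ^ 2 / 3 := by nlinarith
  have q4 : q ^ 4 ≤ q ^ 3 / 3 := by nlinarith
  have hb : |7 - 15 * q + q ^ 2 - q ^ 3| * ‖w‖ ≤ (7 - 15 * q + q ^ 2) * q := by
    rw [abs_of_nonneg (by linarith)]
    exact mul_le_mul (by linarith) hw (norm_nonneg _) (by linarith)
  have hc : |7 - 35 * q + 35 * q ^ 2 - 7 * q ^ 3| * ‖w‖ ^ 2 ≤ 7 * q ^ 2 := by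
    refine mul_le_mul (abs_le.2 ⟨?_, ?_⟩) (by gcongr) (by positivity) (by norm_num) <;> linarith
  have hd : |1 - q + 15 * q ^ 2 - 7 * q ^ 3| * ‖w‖ ^ 3 ≤ 3 * q ^ 3 := by
    refine mul_le_mul (abs_le.2 ⟨?_, ?_⟩) (by gcongr) (by positivity) (by norm_num) <;> linarith
  have he : |3 * q ^ 2 + q ^ 3| * ‖w‖ ^ 4 ≤ 1 * q ^ 4 := by
    refine mul_le_mul (abs_le.2 ⟨?_, ?_⟩) (by gcongr) (by positivity) (by norm_num) <;> linarith
  nlinarith [sq_nonneg (q - 1 / 4)]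

theorem norm_numerator_le {p : ℕ} {q : ℝ} (hpq : (p : ℝ) * q = 1) (h0 : 0 ≤ q) (h1 : q ≤ 1 / 3)
    {w : ℂ} (hw : ‖w‖ ≤ q) :
    ‖(1 - (q : ℂ)) ^ 3 * (1 - w) ^ 7 * (1 - p * w ^ 2)‖ ≤ 6 := by
  have hq : ‖1 - (q : ℂ)‖ = 1 - q := by
    rw [← Complex.ofReal_one, ← Complex.ofReal_sub, Complex.norm_real, Real.norm_eq_abs,
      abs_of_nonneg (by linarith)]
  have hw1 : ‖1 - w‖ ≤ 1 + q := (norm_sub_le _ _).trans (by simpa using hw)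
  have hpw : ‖1 - (p : ℂ) * w ^ 2‖ ≤ 1 + q := by
    refine (norm_sub_le _ _).trans ?_
    rw [norm_one, norm_mul, norm_pow, Complex.norm_natCast]
    have : (p : ℝ) * ‖w‖ ^ 2 ≤ p * q ^ 2 := by gcongr
    nlinarith
  rw [norm_mul, norm_mul, norm_pow, norm_pow, hq]
  calc (1 - q) ^ 3 * ‖1 - w‖ ^ 7 * ‖1 - (p : ℂ) * w ^ 2‖
      ≤ (1 - q) ^ 3 * (1 + q) ^ 7 * (1 + q) := by
        have : 0 ≤ 1 - q := by linarith
        gcongr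
    _ = (1 - q ^ 2) ^ 3 * (1 + q) ^ 5 := by ring
    _ ≤ 1 ^ 3 * (1 + 1 / 3) ^ 5 := by
        have : 0 ≤ 1 - q ^ 2 := by nlinarith
        gcongr
        nlinarith
    _ ≤ 6 := by norm_num

theorem stmt5 (p : ℕ) (hp : p.Prime) (hodd : Odd p) (z : ℂ)
    (hz : ‖z‖ ≤ (p : ℝ) ^ (-(1 / 2) : ℝ)) :
    Dpoly p z ≠ 0 ∧
    ‖(1 - (p : ℂ)⁻¹) ^ 3 * (1 - z ^ 2) ^ 7 * (1 - (p : ℂ) * z ^ 4) / Dpoly p z‖ < 25 := by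
  have hp3 : 3 ≤ p := by
    have := hp.two_le
    obtain ⟨k, hk⟩ := hodd
    omega
  have hp3' : (3 : ℝ) ≤ p := by exact_mod_cast hp3
  have hp0 : (0 : ℝ) < p := by linarith
  have h0 : 0 ≤ (p : ℝ)⁻¹ := by positivity
  have h1 : (p : ℝ)⁻¹ ≤ 1 / 3 := by
    rw [one_div]
    gcongr
  have hw : ‖z ^ 2‖ ≤ (p : ℝ)⁻¹ := by
    rw [norm_pow]
    calc ‖z‖ ^ 2 ≤ ((p : ℝ) ^ (-(1 / 2) : ℝ)) ^ 2 := by gcongr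
      _ = (p : ℝ)⁻¹ := by
        rw [← Real.rpow_natCast, ← Real.rpow_mul hp0.le, ← Real.rpow_neg_one]
        norm_num
  have hD : 1 / 4 < ‖Dpoly p z‖ := by
    convert norm_denominator_gt h0 h1 hw using 2
    rw [Dpoly]
    push_cast
    ring
  have hN := norm_numerator_le (mul_inv_cancel₀ hp0.ne') h0 h1 hw
  rw [← pow_mul, Complex.ofReal_inv, Complex.ofReal_natCast] at hN
  refine ⟨norm_pos_iff.1 (by linarith), ?_⟩
  rw [norm_div, div_lt_iff₀ (by linarith)]
  linarith
end

section
/- For every odd prime p and every complex number z with |z| ≤ p^{−1/2}, one has |f_even^−(z; p)| ≤ ((3 + 11p^{−1} + 20p^{−2} + 20p^{−3} + 11p^{−4} + 3p^{−5}) / (1 − p^{−1})^{10}) · p^{−1/2}, where f_even^−(z; p) = (3 + p^{−1} + (10 − 17p^{−1} + 3p^{−2})z² + (3 − 17p^{−1} + 10p^{−2})z⁴ + (p^{−1} + 3p^{−2})z⁶) / (√p · (1 − p^{−1})³ (1 − z²)⁶ (1 − p z⁴)). -/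
open Complex

/-- The generating function `f_even⁻(z; p)`. -/
noncomputable def fEvenMinus (p : ℕ) (z : ℂ) : ℂ :=
  (3 + (p : ℂ)⁻¹ + (10 - 17 * (p : ℂ)⁻¹ + 3 * (p : ℂ)⁻¹ ^ 2) * z ^ 2
      + (3 - 17 * (p : ℂ)⁻¹ + 10 * (p : ℂ)⁻¹ ^ 2) * z ^ 4
      + ((p : ℂ)⁻¹ + 3 * (p : ℂ)⁻¹ ^ 2) * z ^ 6) /
    ((Real.sqrt p : ℂ) * (1 - (p : ℂ)⁻¹) ^ 3 * (1 - z ^ 2) ^ 6 * (1 - (p : ℂ) * z ^ 4))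

/-- Triangle-inequality bound for the numerator of `f_even⁻`, written in terms of `x = p⁻¹` and
`w = z ^ 2`. -/
lemma norm_fEvenMinus_numerator_le {x : ℝ} (hx : 0 ≤ x) {w : ℂ} (hw : ‖w‖ ≤ x) :
    ‖3 + (x : ℂ) + (10 - 17 * (x : ℂ) + 3 * (x : ℂ) ^ 2) * w
        + (3 - 17 * (x : ℂ) + 10 * (x : ℂ) ^ 2) * w ^ 2
        + ((x : ℂ) + 3 * (x : ℂ) ^ 2) * w ^ 3‖ ≤
      3 + 11 * x + 20 * x ^ 2 + 20 * x ^ 3 + 11 * x ^ 4 + 3 * x ^ 5 := by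
  have h₀ : ‖3 + (x : ℂ)‖ ≤ 3 + x := by
    rw [show 3 + (x : ℂ) = ((3 + x : ℝ) : ℂ) by push_cast; ring, norm_real, Real.norm_eq_abs,
      abs_of_nonneg (by positivity)]
  have h₁ : ‖10 - 17 * (x : ℂ) + 3 * (x : ℂ) ^ 2‖ ≤ 10 + 17 * x + 3 * x ^ 2 := by
    rw [show 10 - 17 * (x : ℂ) + 3 * (x : ℂ) ^ 2 = ((10 - 17 * x + 3 * x ^ 2 : ℝ) : ℂ) by
      push_cast; ring, norm_real, Real.norm_eq_abs, abs_le]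
    constructor <;> nlinarith [sq_nonneg x]
  have h₂ : ‖3 - 17 * (x : ℂ) + 10 * (x : ℂ) ^ 2‖ ≤ 3 + 17 * x + 10 * x ^ 2 := by
    rw [show 3 - 17 * (x : ℂ) + 10 * (x : ℂ) ^ 2 = ((3 - 17 * x + 10 * x ^ 2 : ℝ) : ℂ) by
      push_cast; ring, norm_real, Real.norm_eq_abs, abs_le]
    constructor <;> nlinarith [sq_nonneg x]
  have h₃ : ‖(x : ℂ) + 3 * (x : ℂ) ^ 2‖ ≤ x + 3 * x ^ 2 := by
    rw [show (x : ℂ) + 3 * (x : ℂ) ^ 2 = ((x + 3 * x ^ 2 : ℝ) : ℂ) by push_cast; ring,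
      norm_real, Real.norm_eq_abs, abs_of_nonneg (by positivity)]
  refine norm_add₄_le.trans ?_
  simp only [norm_mul, norm_pow]
  calc _ ≤ (3 + x) + (10 + 17 * x + 3 * x ^ 2) * x + (3 + 17 * x + 10 * x ^ 2) * x ^ 2
        + (x + 3 * x ^ 2) * x ^ 3 := by gcongr
    _ = _ := by ring

lemma one_sub_le_norm_one_sub {x : ℝ} {w : ℂ} (hw : ‖w‖ ≤ x) : 1 - x ≤ ‖1 - w‖ := by
  have h := norm_sub_norm_le (1 : ℂ) w
  rw [norm_one] at h
  linarith

theorem stmt8 (p : ℕ) (hp : p.Prime) (hodd : Odd p) (z : ℂ)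
    (hz : ‖z‖ ≤ (p : ℝ) ^ (-(1 / 2) : ℝ)) :
    ‖fEvenMinus p z‖ ≤
      (3 + 11 * (p : ℝ)⁻¹ + 20 * (p : ℝ)⁻¹ ^ 2 + 20 * (p : ℝ)⁻¹ ^ 3 + 11 * (p : ℝ)⁻¹ ^ 4
          + 3 * (p : ℝ)⁻¹ ^ 5) / (1 - (p : ℝ)⁻¹) ^ 10 * (p : ℝ) ^ (-(1 / 2) : ℝ) := by
  have hp1 : (1 : ℝ) < p := by exact_mod_cast hp.one_lt
  have hp0 : (0 : ℝ) < p := by linarith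
  have hsqrt : (p : ℝ) ^ (-(1 / 2) : ℝ) = (Real.sqrt p)⁻¹ := by
    rw [Real.rpow_neg hp0.le, Real.sqrt_eq_rpow]
  rw [hsqrt] at hz ⊢
  have hs0 : 0 < Real.sqrt p := Real.sqrt_pos.mpr hp0
  obtain ⟨x, hx⟩ : ∃ x : ℝ, x = (p : ℝ)⁻¹ := ⟨_, rfl⟩
  have hx0 : 0 < x := hx ▸ inv_pos.mpr hp0
  have hx1 : 0 < 1 - x := by
    rw [hx]
    exact sub_pos.mpr (inv_lt_one_of_one_lt₀ hp1)
  have hpx : (p : ℝ) * x = 1 := by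
    rw [hx]
    exact mul_inv_cancel₀ hp0.ne'
  have hxc : (p : ℂ)⁻¹ = (x : ℂ) := by
    rw [hx]
    push_cast
    rfl
  have hw : ‖z ^ 2‖ ≤ x := by
    rw [norm_pow, hx]
    calc ‖z‖ ^ 2 ≤ (Real.sqrt p)⁻¹ ^ 2 := by gcongr
      _ = (p : ℝ)⁻¹ := by rw [inv_pow, Real.sq_sqrt hp0.le]
  have hpw : ‖(p : ℂ) * z ^ 4‖ ≤ x := by
    rw [show z ^ 4 = (z ^ 2) ^ 2 by ring, norm_mul, norm_pow (z ^ 2), Complex.norm_natCast]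
    calc (p : ℝ) * ‖z ^ 2‖ ^ 2 ≤ p * x ^ 2 := by gcongr
      _ = p * x * x := by ring
      _ = x := by rw [hpx, one_mul]
  have hnum := norm_fEvenMinus_numerator_le hx0.le hw
  have hden₁ := one_sub_le_norm_one_sub hw
  have hden₂ := one_sub_le_norm_one_sub hpw
  have hden₀ : ‖1 - (x : ℂ)‖ = 1 - x := by
    rw [← ofReal_one, ← ofReal_sub, norm_real, Real.norm_of_nonneg hx1.le]
  rw [← pow_mul, ← pow_mul] at hnum
  rw [fEvenMinus, hxc, ← hx, norm_div, ← div_eq_mul_inv, div_div]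
  refine div_le_div₀ (by positivity) hnum (by positivity) ?_
  rw [norm_mul, norm_mul, norm_mul, norm_pow, norm_pow, hden₀, norm_real,
    Real.norm_of_nonneg hs0.le]
  calc (1 - x) ^ 10 * Real.sqrt p
      = Real.sqrt p * (1 - x) ^ 3 * (1 - x) ^ 6 * (1 - x) := by ring
    _ ≤ _ := by gcongr
end

section
/- For every prime p ≥ 11 and every complex number z with |z| ≤ p^{−1/2}, one has |D_p(z)| ≥ 1 − 4p^{−1} − 22p^{−2} − 37p^{−3} − 37p^{−4} − 22p^{−5} − 10p^{−6} − p^{−7} > 2/5, where D_p(z) = 1 + 3p^{−1} + (7 − 15p^{−1} + p^{−2} − p^{−3})z² + (7 − 35p^{−1} + 35p^{−2} − 7p^{−3})z⁴ + (1 − p^{−1} + 15p^{−2} − 7p^{−3})z⁶ − (3p^{−2} + p^{−3})z⁸. -/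
open Complex

/-- A lower bound for the norm of a quartic polynomial at a point of norm at most `t`, given upper
bounds for the norms of its nonconstant coefficients. -/
theorem le_norm_quartic {a b c d e w : ℂ} {B C D E t : ℝ} (hw : ‖w‖ ≤ t)
    (hb : ‖b‖ ≤ B) (hc : ‖c‖ ≤ C) (hd : ‖d‖ ≤ D) (he : ‖e‖ ≤ E) :
    ‖a‖ - B * t - C * t ^ 2 - D * t ^ 3 - E * t ^ 4 ≤
      ‖a + b * w + c * w ^ 2 + d * w ^ 3 - e * w ^ 4‖ := by
  have bound {x : ℂ} {X : ℝ} (n : ℕ) (hx : ‖x‖ ≤ X) : ‖x * w ^ n‖ ≤ X * t ^ n := by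
    rw [norm_mul, norm_pow]
    have := (norm_nonneg x).trans hx
    gcongr
  have h₁ := bound 1 hb
  rw [pow_one, pow_one] at h₁
  linarith [bound 2 hc, bound 3 hd, bound 4 he,
    norm_sub_le_norm_add a (b * w), norm_sub_le_norm_add (a + b * w) (c * w ^ 2),
    norm_sub_le_norm_add (a + b * w + c * w ^ 2) (d * w ^ 3),
    norm_sub_norm_le (a + b * w + c * w ^ 2 + d * w ^ 3) (e * w ^ 4)]

theorem stmt10 (p : ℕ) (hp : p.Prime) (hp11 : 11 ≤ p) (z : ℂ)
    (hz : ‖z‖ ≤ (p : ℝ) ^ (-(1 / 2) : ℝ)) :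
    ‖Dpoly p z‖ ≥
      1 - 4 * (p : ℝ)⁻¹ - 22 * (p : ℝ)⁻¹ ^ 2 - 37 * (p : ℝ)⁻¹ ^ 3 - 37 * (p : ℝ)⁻¹ ^ 4
        - 22 * (p : ℝ)⁻¹ ^ 5 - 10 * (p : ℝ)⁻¹ ^ 6 - (p : ℝ)⁻¹ ^ 7 ∧
    1 - 4 * (p : ℝ)⁻¹ - 22 * (p : ℝ)⁻¹ ^ 2 - 37 * (p : ℝ)⁻¹ ^ 3 - 37 * (p : ℝ)⁻¹ ^ 4
        - 22 * (p : ℝ)⁻¹ ^ 5 - 10 * (p : ℝ)⁻¹ ^ 6 - (p : ℝ)⁻¹ ^ 7 > 2 / 5 := by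
  obtain ⟨t, ht⟩ : ∃ t : ℝ, t = (p : ℝ)⁻¹ := ⟨_, rfl⟩
  have ht0 : 0 < t := by rw [ht]; positivity
  have ht11 : t ≤ 1 / 11 := by
    rw [ht, inv_eq_one_div]
    gcongr
    exact_mod_cast hp11
  have hpt : (p : ℂ)⁻¹ = (t : ℂ) := by rw [ht]; push_cast; rfl
  have hw : ‖z ^ 2‖ ≤ t := by
    rw [norm_pow]
    calc ‖z‖ ^ 2 ≤ ((p : ℝ) ^ (-(1 / 2) : ℝ)) ^ 2 := by gcongr
      _ = t := by
        rw [← Real.rpow_natCast, ← Real.rpow_mul p.cast_nonneg, ht, ← Real.rpow_neg_one]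
        norm_num
  have hpow (n : ℕ) : t ^ n * t ≤ t ^ n * (1 / 11) := by gcongr
  have h₁ := hpow 1
  have h₂ := hpow 2
  have h₃ := hpow 3
  have h₄ := hpow 4
  have h₅ := hpow 5
  have h₆ := hpow 6
  rw [← ht]
  refine ⟨?_, by linarith⟩
  have ha : ‖1 + 3 * (t : ℂ)‖ = 1 + 3 * t := by
    rw [show 1 + 3 * (t : ℂ) = ((1 + 3 * t : ℝ) : ℂ) by push_cast; rfl, norm_real,
      Real.norm_of_nonneg (by positivity)]
  have hb : ‖7 - 15 * (t : ℂ) + (t : ℂ) ^ 2 - (t : ℂ) ^ 3‖ ≤ 7 + 15 * t + t ^ 2 + t ^ 3 := by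
    norm_cast
    rw [Real.norm_eq_abs, abs_le]
    constructor <;> nlinarith [pow_pos ht0 2, pow_pos ht0 3]
  have hc : ‖7 - 35 * (t : ℂ) + 35 * (t : ℂ) ^ 2 - 7 * (t : ℂ) ^ 3‖ ≤
      7 + 35 * t + 35 * t ^ 2 + 7 * t ^ 3 := by
    norm_cast
    rw [Real.norm_eq_abs, abs_le]
    constructor <;> nlinarith [pow_pos ht0 2, pow_pos ht0 3]
  have hd : ‖1 - (t : ℂ) + 15 * (t : ℂ) ^ 2 - 7 * (t : ℂ) ^ 3‖ ≤
      1 + t + 15 * t ^ 2 + 7 * t ^ 3 := by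
    norm_cast
    rw [Real.norm_eq_abs, abs_le]
    constructor <;> nlinarith [pow_pos ht0 2, pow_pos ht0 3]
  have he : ‖3 * (t : ℂ) ^ 2 + (t : ℂ) ^ 3‖ ≤ 3 * t ^ 2 + t ^ 3 := by
    norm_cast
    rw [Real.norm_of_nonneg (by positivity)]
  have key := le_norm_quartic (a := 1 + 3 * (t : ℂ)) hw hb hc hd he
  rw [ha] at key
  simp only [← pow_mul] at key
  norm_num only at key
  rw [Dpoly, hpt, ge_iff_le]
  refine le_trans (le_of_eq ?_) key
  ring
end

section
/- For every complex number z with |z| ≤ 5^{−1/2}, one has |8/5 − (8z²/125)(2z⁶ − 21z⁴ − 21z² − 63)| > 2/5. -/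
theorem stmt13 (z : ℂ) (hz : ‖z‖ ≤ (5 : ℝ) ^ (-(1 / 2) : ℝ)) :
    ‖(8 : ℂ) / 5 - 8 * z ^ 2 / 125 * (2 * z ^ 6 - 21 * z ^ 4 - 21 * z ^ 2 - 63)‖ > 2 / 5 := by
  have hsq : ‖z‖ ^ 2 ≤ 1 / 5 := by
    calc ‖z‖ ^ 2 ≤ ((5 : ℝ) ^ (-(1 / 2) : ℝ)) ^ 2 := by gcongr
      _ = 1 / 5 := by
        rw [← Real.rpow_natCast, ← Real.rpow_mul (by norm_num)]
        norm_num [Real.rpow_neg_one]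
  have h4 : ‖z‖ ^ 4 ≤ 1 / 25 := by
    calc ‖z‖ ^ 4 = (‖z‖ ^ 2) ^ 2 := by ring
      _ ≤ (1 / 5) ^ 2 := by gcongr
      _ = 1 / 25 := by norm_num
  have h6 : ‖z‖ ^ 6 ≤ 1 / 125 := by
    calc ‖z‖ ^ 6 = (‖z‖ ^ 2) ^ 3 := by ring
      _ ≤ (1 / 5) ^ 3 := by gcongr
      _ = 1 / 125 := by norm_num
  have hfactor : ‖2 * z ^ 6 - 21 * z ^ 4 - 21 * z ^ 2 - 63‖ ≤ 70 := by
    have h₁ := norm_sub_le (2 * z ^ 6 - 21 * z ^ 4 - 21 * z ^ 2) 63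
    have h₂ := norm_sub_le (2 * z ^ 6 - 21 * z ^ 4) (21 * z ^ 2)
    have h₃ := norm_sub_le (2 * z ^ 6) (21 * z ^ 4)
    simp only [norm_mul, norm_pow, Complex.norm_ofNat] at h₁ h₂ h₃
    linarith
  have hprod : ‖8 * z ^ 2 / 125 * (2 * z ^ 6 - 21 * z ^ 4 - 21 * z ^ 2 - 63)‖ ≤
      8 * (1 / 5) / 125 * 70 := by
    rw [norm_mul, norm_div, norm_mul, norm_pow, Complex.norm_ofNat, Complex.norm_ofNat]
    gcongr
  have htriangle := norm_sub_norm_le ((8 : ℂ) / 5)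
    (8 * z ^ 2 / 125 * (2 * z ^ 6 - 21 * z ^ 4 - 21 * z ^ 2 - 63))
  rw [norm_div, Complex.norm_ofNat, Complex.norm_ofNat] at htriangle
  linarith
end

section
/- One has the Gamma-function identity (2^{−1/4} + 7·2^{−11/4} + 2^{−13/4} + 2^{−15/4}) · π · [ (Γ(1/8)/Γ(3/8) + Γ(5/8)/Γ(7/8)) · (Γ(1/8)/Γ(3/8))³ + (Γ(1/8)/Γ(3/8) − Γ(5/8)/Γ(7/8)) · (Γ(5/8)/Γ(7/8))³ ] = (9/8) · 2^{1/4} · (6 + 5√2) · Γ(1/4)⁴ / π. -/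
open Real

lemma rpow_neg_fifteen_quarters_add_nat (n : ℕ) :
    (2 : ℝ) ^ ((n : ℝ) / 4 - 15 / 4) = ((2 : ℝ) ^ ((1 : ℝ) / 4)) ^ (n + 1) / 16 := by
  rw [← rpow_natCast, ← rpow_mul (by norm_num),
    show (n : ℝ) / 4 - 15 / 4 = 1 / 4 * ((n + 1 : ℕ) : ℝ) - (4 : ℕ) by push_cast; ring,
    rpow_sub (by norm_num), rpow_natCast]
  norm_num

lemma two_rpow_quarter_sq : ((2 : ℝ) ^ ((1 : ℝ) / 4)) ^ 2 = √2 := by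
  rw [← rpow_natCast, ← rpow_mul (by norm_num), sqrt_eq_rpow]
  norm_num

lemma cos_pi_div_eight_eq : cos (π / 8) = (1 + √2) * sin (π / 8) := by
  have hs : 0 < cos (π / 8) := cos_pos_of_mem_Ioo ⟨by linarith [pi_pos], by linarith [pi_pos]⟩
  have h2 : √2 = 2 * (2 * sin (π / 8) * cos (π / 8)) := by
    rw [← sin_two_mul, show 2 * (π / 8) = π / 4 by ring, sin_pi_div_four]; ring
  have h3 : √2 = 2 * (2 * cos (π / 8) ^ 2 - 1) := by
    rw [← cos_two_mul, show 2 * (π / 8) = π / 4 by ring, cos_pi_div_four]; ring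
  apply mul_left_cancel₀ hs.ne'
  have h4 : √2 ^ 2 = 2 := sq_sqrt (by norm_num)
  linear_combination (-(1 / 4)) * h3 + (1 + √2) / 4 * h2 - 1 / 4 * h4

lemma Gamma_eighths_ratio :
    Gamma (1 / 8) / Gamma (3 / 8) = (1 + √2) * (Gamma (5 / 8) / Gamma (7 / 8)) := by
  have h1 := Gamma_mul_Gamma_one_sub (1 / 8)
  have h3 := Gamma_mul_Gamma_one_sub (3 / 8)
  rw [show (1 : ℝ) - 1 / 8 = 7 / 8 by norm_num, show π * (1 / 8) = π / 8 by ring] at h1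
  rw [show (1 : ℝ) - 3 / 8 = 5 / 8 by norm_num, show π * (3 / 8) = π / 2 - π / 8 by ring,
    sin_pi_div_two_sub, cos_pi_div_eight_eq] at h3
  have hs : 0 < sin (π / 8) := sin_pos_of_pos_of_lt_pi (by positivity) (by linarith [pi_pos])
  have hb : 0 < Gamma (3 / 8) := Gamma_pos_of_pos (by norm_num)
  have hd : 0 < Gamma (7 / 8) := Gamma_pos_of_pos (by norm_num)
  have h : Gamma (1 / 8) * Gamma (7 / 8) = (1 + √2) * (Gamma (3 / 8) * Gamma (5 / 8)) := by
    rw [h1, h3]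
    field_simp
  field_simp
  linear_combination h

lemma Gamma_eighths_mul :
    (Gamma (1 / 8) / Gamma (3 / 8)) * (Gamma (5 / 8) / Gamma (7 / 8)) =
      Gamma (1 / 4) ^ 2 / π := by
  have h1 := Gamma_mul_Gamma_add_half (1 / 8)
  have h3 := Gamma_mul_Gamma_add_half (3 / 8)
  have h4 := Gamma_mul_Gamma_one_sub (1 / 4)
  rw [show (1 : ℝ) - 1 / 4 = 3 / 4 by norm_num, show π * (1 / 4) = π / 4 by ring,
    sin_pi_div_four] at h4
  rw [show (1 : ℝ) / 8 + 1 / 2 = 5 / 8 by norm_num, show (2 : ℝ) * (1 / 8) = 1 / 4 by norm_num,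
    show (1 : ℝ) - 1 / 4 = 1 / 4 + 1 / 2 by norm_num, rpow_add (by norm_num),
    ← sqrt_eq_rpow] at h1
  rw [show (3 : ℝ) / 8 + 1 / 2 = 7 / 8 by norm_num, show (2 : ℝ) * (3 / 8) = 3 / 4 by norm_num,
    show (1 : ℝ) - 3 / 4 = 1 / 4 by norm_num] at h3
  have hg : 0 < Gamma (1 / 4) := Gamma_pos_of_pos (by norm_num)
  have hg' : 0 < Gamma (3 / 4) := Gamma_pos_of_pos (by norm_num)
  have ht : (0 : ℝ) < 2 ^ ((1 : ℝ) / 4) := by positivity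
  have hs : √2 ^ 2 = 2 := sq_sqrt (by norm_num)
  rw [div_mul_div_comm, h1, h3]
  field_simp at h4 ⊢
  linear_combination -h4 * √2 / 2 + (Gamma (1 / 4) * Gamma (3 / 4)) / 2 * hs

theorem stmt15 :
    ((2 : ℝ) ^ (-(1 / 4) : ℝ) + 7 * (2 : ℝ) ^ (-(11 / 4) : ℝ) + (2 : ℝ) ^ (-(13 / 4) : ℝ)
        + (2 : ℝ) ^ (-(15 / 4) : ℝ)) * π *
      ((Gamma (1 / 8) / Gamma (3 / 8) + Gamma (5 / 8) / Gamma (7 / 8)) *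
          (Gamma (1 / 8) / Gamma (3 / 8)) ^ 3 +
        (Gamma (1 / 8) / Gamma (3 / 8) - Gamma (5 / 8) / Gamma (7 / 8)) *
          (Gamma (5 / 8) / Gamma (7 / 8)) ^ 3) =
    9 / 8 * (2 : ℝ) ^ ((1 : ℝ) / 4) * (6 + 5 * Real.sqrt 2) * Gamma (1 / 4) ^ 4 / π := by
  have e0 := rpow_neg_fifteen_quarters_add_nat 0
  have e2 := rpow_neg_fifteen_quarters_add_nat 2
  have e4 := rpow_neg_fifteen_quarters_add_nat 4
  have e14 := rpow_neg_fifteen_quarters_add_nat 14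
  norm_num only [Nat.cast_ofNat, Nat.cast_zero] at e0 e2 e4 e14
  have hq := two_rpow_quarter_sq
  have hm := Gamma_eighths_mul
  rw [Gamma_eighths_ratio] at hm ⊢
  norm_num only at hq hm ⊢
  rw [e0, e2, e4, e14]
  set t := (2 : ℝ) ^ ((1 : ℝ) / 4)
  set B := Gamma (5 / 8) / Gamma (7 / 8)
  have hs : √2 ^ 2 = 2 := sq_sqrt (by norm_num)
  have hg : Gamma (1 / 4) ^ 4 / π = π * ((1 + √2) * B * B) ^ 2 := by
    rw [hm]
    field_simp
  have p3 : t ^ 3 = t * √2 := by rw [← hq]; ring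
  have p5 : t ^ 5 = 2 * t := by rw [← hs, ← hq]; ring
  have p15 : t ^ 15 = 8 * t * √2 := by
    calc t ^ 15 = t * (t ^ 2) ^ 7 := by ring
      _ = t * ((√2 ^ 2) ^ 3 * √2) := by rw [hq]; ring
      _ = 8 * t * √2 := by rw [hs]; ring
  rw [mul_div_assoc, hg, p3, p5, p15]
  have s3 : √2 ^ 3 = 2 * √2 := by rw [pow_succ, hs]
  have s4 : √2 ^ 4 = 4 := by rw [show √2 ^ 4 = (√2 ^ 2) ^ 2 by ring, hs]; norm_num
  have s5 : √2 ^ 5 = 4 * √2 := by rw [pow_succ, s4]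
  ring_nf
  simp only [hs, s3, s4, s5]
  ring
end
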